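/- Let κ_0 ∈ (0,1), α > κ_0/2, β ∈ (0,1), γ > 0, μ > 0, t > 0. Then lim_{ε→0⁺} ∫_ℝ E_β²(−μ|λ|^α (1 + λ²ε²)^{γ/2} t^β) (1 − θ_{κ_0}(|λ|ε)) |λ|^{κ_0−1} dλ = ∫_ℝ E_β²(−μ|λ|^α t^β) |λ|^{κ_0−1} dλ, and both integrals are finite. -/

import Mathlib

open Real Filter Topology MeasureTheory

/-- The Mittag-Leffler function `E_β(s) = ∑_{k=0}^∞ s^k / Γ(1 + βk)`. -/
noncomputable def mittagLeffler (β s : ℝ) : ℝ := ∑' k : ℕ, s ^ k / Real.Gamma (1 + β * k)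

/-- The modified Bessel function of the second kind
`K_ν(z) = (1/2) ∫_0^∞ s^{ν−1} exp(−(z/2)(s + 1/s)) ds`. -/
noncomputable def besselK (ν z : ℝ) : ℝ :=
  (1 / 2) * ∫ s in Set.Ioi (0 : ℝ), s ^ (ν - 1) * Real.exp (-(z / 2) * (s + 1 / s))

/-- `θ_κ(z) = 1 − (2^{(3−κ)/2} Γ(κ) cos(πκ/2)/(√π Γ(κ/2))) z^{(1−κ)/2} K_{(κ−1)/2}(z)`. -/
noncomputable def theta (κ z : ℝ) : ℝ :=
  1 - (2 : ℝ) ^ ((3 - κ) / 2) * Real.Gamma κ * Real.cos (Real.pi * κ / 2) /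
      (Real.sqrt Real.pi * Real.Gamma (κ / 2)) * z ^ ((1 - κ) / 2) * besselK ((κ - 1) / 2) z

/-- Two-parameter Mittag-Leffler function. -/
noncomputable def ML2 (β b y : ℝ) : ℝ := ∑' k : ℕ, y ^ k / Real.Gamma (b + β * k)

lemma gamma_lower {x A : ℝ} (hx : 1 ≤ x) (hA : 0 < A) :
    A ^ (x - 1) * Real.exp (-(A + 1)) ≤ Real.Gamma x := by
  rw [Real.Gamma_eq_integral (by linarith)]
  have hint := Real.GammaIntegral_convergent (s := x) (by linarith)
  calc A ^ (x - 1) * Real.exp (-(A + 1))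
      = ∫ s in Set.Ioc A (A + 1), A ^ (x - 1) * Real.exp (-(A + 1)) := by simp
    _ ≤ ∫ s in Set.Ioc A (A + 1), Real.exp (-s) * s ^ (x - 1) := by
        apply setIntegral_mono_on
        · exact integrableOn_const (by simp)
        · exact hint.mono_set (fun s hs => lt_trans hA hs.1)
        · exact measurableSet_Ioc
        · intro s hs
          rw [mul_comm]
          have h1 : A ^ (x - 1) ≤ s ^ (x - 1) :=
            Real.rpow_le_rpow hA.le hs.1.le (by linarith)
          have h2 : Real.exp (-(A + 1)) ≤ Real.exp (-s) :=
            Real.exp_le_exp.2 (by linarith [hs.2])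
          have h3 := Real.rpow_nonneg hA.le (x - 1)
          gcongr
    _ ≤ ∫ s in Set.Ioi 0, Real.exp (-s) * s ^ (x - 1) := by
        apply setIntegral_mono_set hint
        · filter_upwards [ae_restrict_mem measurableSet_Ioi] with s hs
          have : (0:ℝ) < s := hs
          simp only [Pi.zero_apply]
          positivity
        · exact (show Set.Ioc A (A+1) ⊆ Set.Ioi 0 from
            fun s hs => lt_trans hA hs.1).eventuallyLE

lemma ml_summable {β b : ℝ} (hβ : 0 < β) (hb : 0 < b) {R : ℝ} (hR : 0 ≤ R) :
    Summable (fun k : ℕ => R ^ k / Real.Gamma (b + β * k)) := by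
  set A : ℝ := (2 * (R + 1)) ^ (1 / β) with hA
  have hA0 : 0 < A := by positivity
  have hAβ : A ^ β = 2 * (R + 1) := by
    rw [hA, ← Real.rpow_mul (by positivity), one_div, inv_mul_cancel₀ hβ.ne', Real.rpow_one]
  have hC : 0 < A ^ (b - 1) * Real.exp (-(A + 1)) := by positivity
  have hs : Summable (fun k : ℕ => (A ^ (b - 1) * Real.exp (-(A + 1)))⁻¹ * (1 / 2 : ℝ) ^ k) :=
    (summable_geometric_of_lt_one (by norm_num) (by norm_num)).mul_left _
  refine hs.of_norm_bounded_eventually_nat ?_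
  obtain ⟨N, hN⟩ := exists_nat_ge (1 / β)
  filter_upwards [eventually_ge_atTop N] with k hk
  have hk' : 1 / β ≤ k := hN.trans (by exact_mod_cast hk)
  have h1 : 1 ≤ β * k := by
    rw [div_le_iff₀ hβ] at hk'; linarith
  have hg := gamma_lower (x := b + β * k) (by linarith) hA0
  have e : A ^ (b + β * k - 1) = A ^ (b - 1) * (2 * (R + 1)) ^ k := by
    rw [show b + β * k - 1 = (b - 1) + β * k by ring, Real.rpow_add hA0, Real.rpow_mul hA0.le,
      hAβ, Real.rpow_natCast]
  have hG : 0 < Real.Gamma (b + β * k) := Real.Gamma_pos_of_pos (by linarith)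
  rw [Real.norm_of_nonneg (by positivity)]
  rw [div_le_iff₀ hG]
  rw [e] at hg
  calc R ^ k ≤ (R + 1) ^ k := by gcongr; linarith
    _ = (A ^ (b - 1) * Real.exp (-(A + 1)))⁻¹ * (1 / 2 : ℝ) ^ k *
        (A ^ (b - 1) * (2 * (R + 1)) ^ k * Real.exp (-(A + 1))) := by
        rw [mul_pow, one_div, inv_pow]
        field_simp
    _ ≤ _ := by gcongr

lemma ml_summable' {β b : ℝ} (hβ : 0 < β) (hb : 0 < b) (y : ℝ) :
    Summable (fun k : ℕ => y ^ k / Real.Gamma (b + β * k)) := by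
  refine (ml_summable hβ hb (abs_nonneg y)).of_norm_bounded (fun k => ?_)
  have hG : 0 < Real.Gamma (b + β * k) := Real.Gamma_pos_of_pos (by positivity)
  rw [norm_div, norm_pow, Real.norm_eq_abs, Real.norm_of_nonneg hG.le]

lemma ml_continuous {β b : ℝ} (hβ : 0 < β) (hb : 0 < b) : Continuous (ML2 β b) := by
  rw [continuous_iff_continuousAt]
  intro y
  have h : ContinuousOn (ML2 β b) (Metric.ball 0 (|y| + 1)) := by
    unfold ML2
    refine continuousOn_tsum (fun k => by fun_prop)
      (ml_summable hβ hb (R := |y| + 1) (by positivity)) (fun k x hx => ?_)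
    have hG : 0 < Real.Gamma (b + β * k) := Real.Gamma_pos_of_pos (by positivity)
    rw [norm_div, norm_pow, Real.norm_of_nonneg hG.le]
    have : ‖x‖ ≤ |y| + 1 := by simpa using (mem_ball_zero_iff.1 hx).le
    gcongr
  exact h.continuousAt (Metric.isOpen_ball.mem_nhds (by simp))

lemma ml_rec {β b : ℝ} (hβ : 0 < β) (hb : 0 < b) (y : ℝ) :
    ML2 β b y = 1 / Real.Gamma b + y * ML2 β (b + β) y := by
  unfold ML2
  rw [(ml_summable' hβ hb y).tsum_eq_zero_add, ← tsum_mul_left]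
  congr 1
  · simp
  · congr 1; ext k
    rw [pow_succ, show b + β + β * (k:ℝ) = b + β * ((k + 1 : ℕ) : ℝ) by push_cast; ring]
    ring

lemma beta_real {a c t : ℝ} (ha : 0 < a) (hc : 0 < c) (ht : 0 < t) :
    ∫ s in Set.Ioc 0 t, s ^ (a - 1) * (t - s) ^ (c - 1)
      = t ^ (a + c - 1) * (Real.Gamma a * Real.Gamma c / Real.Gamma (a + c)) := by
  have h := Complex.betaIntegral_scaled a c ht
  rw [Complex.betaIntegral_eq_Gamma_mul_div _ _ (by simpa) (by simpa),
    intervalIntegral.integral_of_le ht.le] at h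
  apply Complex.ofReal_injective
  rw [← integral_complex_ofReal]
  have e : ∫ s in Set.Ioc 0 t, ((s ^ (a - 1) * (t - s) ^ (c - 1) : ℝ) : ℂ)
      = ∫ s in Set.Ioc 0 t, (s : ℂ) ^ ((a:ℂ) - 1) * ((t:ℂ) - s) ^ ((c:ℂ) - 1) := by
    refine setIntegral_congr_fun measurableSet_Ioc (fun s hs => ?_)
    push_cast [Complex.ofReal_cpow hs.1.le, Complex.ofReal_cpow (sub_nonneg.2 hs.2)]
    rfl
  rw [e, h]
  push_cast [Complex.ofReal_cpow ht.le, ← Complex.Gamma_ofReal]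
  rfl

lemma beta_int {a c t : ℝ} (ha : 0 < a) (hc : 0 < c) (ht : 0 < t) :
    IntegrableOn (fun s => s ^ (a - 1) * (t - s) ^ (c - 1)) (Set.Ioc 0 t) := by
  by_contra h
  have h1 := beta_real ha hc ht
  rw [integral_undef h] at h1
  have := Real.Gamma_pos_of_pos ha
  have := Real.Gamma_pos_of_pos hc
  have := Real.Gamma_pos_of_pos (add_pos ha hc)
  have : 0 < t ^ (a + c - 1) * (Real.Gamma a * Real.Gamma c / Real.Gamma (a + c)) := by positivity
  linarith

/-- `w_b(t) = t^{b-1} E_{β,b}(-t^β)`. -/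
noncomputable def wML (β b t : ℝ) : ℝ := t ^ (b - 1) * ML2 β b (-(t ^ β))

lemma ml_comp_cont {β b : ℝ} (hβ : 0 < β) (hb : 0 < b) :
    Continuous (fun s : ℝ => ML2 β b (-(s ^ β))) :=
  (ml_continuous hβ hb).comp ((Real.continuous_rpow_const hβ.le).neg)

lemma conv_int {β b c t : ℝ} (hβ : 0 < β) (hb : 0 < b) (hc : 0 < c) (ht : 0 < t) :
    IntegrableOn (fun s => (t - s) ^ (c - 1) * wML β b s) (Set.Ioc 0 t) := by
  have h := (beta_int hb hc ht)
  have h2 : IntegrableOn (fun s => (s ^ (b - 1) * (t - s) ^ (c - 1)) * ML2 β b (-(s ^ β)))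
      (Set.Ioc 0 t) := by
    rw [← integrableOn_Icc_iff_integrableOn_Ioc] at h ⊢
    exact h.mul_continuousOn (ml_comp_cont hβ hb).continuousOn isCompact_Icc
  refine h2.congr_fun (fun s _ => ?_) measurableSet_Ioc
  simp only [wML]; ring

lemma conv_eq {β b c t : ℝ} (hβ : 0 < β) (hb : 0 < b) (hc : 0 < c) (ht : 0 < t) :
    ∫ s in Set.Ioc 0 t, (t - s) ^ (c - 1) * wML β b s
      = Real.Gamma c * wML β (b + c) t := by
  set F : ℕ → ℝ → ℝ := fun k s =>
    (s ^ ((b + β * k) - 1) * (t - s) ^ (c - 1)) * ((-1) ^ k / Real.Gamma (b + β * k)) with hF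
  have hpos : ∀ k : ℕ, 0 < b + β * k := fun k => by positivity
  have hFi : ∀ k, Integrable (F k) (volume.restrict (Set.Ioc 0 t)) := fun k =>
    (beta_int (hpos k) hc ht).mul_const _
  have hval : ∀ k, ∫ s in Set.Ioc 0 t, F k s =
      Real.Gamma c * (t ^ (b + c - 1) * ((-(t ^ β)) ^ k / Real.Gamma (b + c + β * k))) := fun k => by
    have hG := (Real.Gamma_pos_of_pos (hpos k)).ne'
    simp only [hF]
    rw [integral_mul_const, beta_real (hpos k) hc ht,
      show b + β * (k:ℝ) + c - 1 = (b + c - 1) + β * k by ring, Real.rpow_add ht,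
      Real.rpow_mul ht.le, Real.rpow_natCast, neg_pow (t ^ β),
      show b + β * (k:ℝ) + c = b + c + β * k by ring]
    field_simp
  have hnorm : ∀ k, ∫ s in Set.Ioc 0 t, ‖F k s‖ =
      Real.Gamma c * (t ^ (b + c - 1) * ((t ^ β) ^ k / Real.Gamma (b + c + β * k))) := fun k => by
    have hG := (Real.Gamma_pos_of_pos (hpos k))
    have e : ∫ s in Set.Ioc 0 t, ‖F k s‖ = ∫ s in Set.Ioc 0 t,
        (s ^ ((b + β * k) - 1) * (t - s) ^ (c - 1)) * (1 / Real.Gamma (b + β * k)) := by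
      refine setIntegral_congr_fun measurableSet_Ioc (fun s hs => ?_)
      have h1 : 0 < s := hs.1
      have h2 : 0 ≤ t - s := sub_nonneg.2 hs.2
      simp only [hF]
      rw [norm_mul, norm_div, norm_pow, norm_neg, norm_one, one_pow, Real.norm_of_nonneg hG.le,
        Real.norm_of_nonneg (by positivity)]
    have hG := hG.ne'
    rw [e, integral_mul_const, beta_real (hpos k) hc ht,
      show b + β * (k:ℝ) + c - 1 = (b + c - 1) + β * k by ring, Real.rpow_add ht,
      Real.rpow_mul ht.le, Real.rpow_natCast,
      show b + β * (k:ℝ) + c = b + c + β * k by ring]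
    field_simp
  have hsum : Summable (fun k => ∫ s in Set.Ioc 0 t, ‖F k s‖) := by
    simp_rw [hnorm]
    exact ((ml_summable hβ (add_pos hb hc) (by positivity)).mul_left _).mul_left _
  have key := integral_tsum_of_summable_integral_norm hFi hsum
  simp_rw [hval] at key
  rw [tsum_mul_left, tsum_mul_left] at key
  rw [wML, ML2, key]
  refine setIntegral_congr_fun measurableSet_Ioc (fun s hs => ?_)
  have hs0 : 0 < s := hs.1
  simp only [hF, wML, ML2]
  rw [← tsum_mul_left, ← tsum_mul_left]
  congr 1; ext k
  rw [show b + β * (k:ℝ) - 1 = (b - 1) + β * k by ring, Real.rpow_add hs0,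
      Real.rpow_mul hs0.le, Real.rpow_natCast, neg_pow (s ^ β)]
  ring

lemma wML_volterra {β b t : ℝ} (hβ : 0 < β) (hb : 0 < b) (ht : 0 < t) :
    Real.Gamma β * (t ^ (b - 1) / Real.Gamma b) = Real.Gamma β * wML β b t +
      ∫ s in Set.Ioc 0 t, (t - s) ^ (β - 1) * wML β b s := by
  rw [conv_eq hβ hb hβ ht]
  simp only [wML]
  rw [ml_rec hβ hb, show b + β - 1 = (b - 1) + β by ring, Real.rpow_add ht]
  ring

lemma kern_int {β t T : ℝ} (hβ : 0 < β) (htT : t ≤ T) :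
    IntegrableOn (fun s => (T - s) ^ (β - 1)) (Set.Ioc t T) ∧
    ∫ s in Set.Ioc t T, (T - s) ^ (β - 1) = (T - t) ^ β / β := by
  constructor
  · rw [← intervalIntegrable_iff_integrableOn_Ioc_of_le htT]
    have h : IntervalIntegrable (fun x : ℝ => x ^ (β - 1)) volume (T - t) (T - T) :=
      intervalIntegral.intervalIntegrable_rpow' (by linarith)
    simpa using h.comp_sub_left T
  · rw [← intervalIntegral.integral_of_le htT,
      intervalIntegral.integral_comp_sub_left (fun x => x ^ (β - 1)) T,
      integral_rpow (Or.inl (by linarith))]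
    simp [Real.zero_rpow hβ.ne']

lemma wML_contOn {β b : ℝ} (hβ : 0 < β) (hb : 0 < b) :
    ContinuousOn (wML β b) (Set.Ioi 0) := by
  unfold wML
  refine ContinuousOn.mul ?_ (ml_comp_cont hβ hb).continuousOn
  exact fun x hx => (Real.continuousAt_rpow_const x _ (Or.inl (ne_of_gt hx))).continuousWithinAt

lemma ml_pos {β b : ℝ} (hβ : 0 < β) (hβ1 : β < 1) (hb : β ≤ b) (hb1 : b ≤ 1) {t : ℝ}
    (ht : 0 ≤ t) : 0 < ML2 β b (-(t ^ β)) := by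
  have hb0 : 0 < b := by linarith
  have hGβ := Real.Gamma_pos_of_pos hβ
  have hGb := Real.Gamma_pos_of_pos hb0
  by_contra hneg
  push Not at hneg
  set S : Set ℝ := {t | 0 ≤ t ∧ ML2 β b (-(t ^ β)) ≤ 0} with hS
  have hSc : IsClosed S :=
    isClosed_Ici.inter (isClosed_le (ml_comp_cont hβ hb0) continuous_const)
  have hSne : S.Nonempty := ⟨t, ht, hneg⟩
  have hSb : BddBelow S := ⟨0, fun x hx => hx.1⟩
  set T := sInf S with hT
  obtain ⟨hT0, hTneg⟩ : T ∈ S := hSc.csInf_mem hSne hSb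
  have hTpos : 0 < T := by
    rcases hT0.lt_or_eq with h | h
    · exact h
    · exfalso
      rw [← h, Real.zero_rpow hβ.ne', ml_rec hβ hb0] at hTneg
      have : 0 < 1 / Real.Gamma b := by positivity
      simp at hTneg
      simp at this
      linarith
  have hlt : ∀ s, 0 < s → s < T → 0 < wML β b s := by
    intro s hs0 hsT
    have : 0 < ML2 β b (-(s ^ β)) := by
      by_contra hc
      exact absurd (csInf_le hSb (show s ∈ S from ⟨hs0.le, not_lt.1 hc⟩)) (not_le.2 hsT)
    unfold wML
    positivity
  have hwT : wML β b T ≤ 0 :=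
    mul_nonpos_of_nonneg_of_nonpos (by positivity) hTneg
  -- choose t0
  obtain ⟨t0, ht01, ht02, ht0d⟩ :
      ∃ t0, T / 2 < t0 ∧ t0 < T ∧ (T - t0) ^ β / β < Real.Gamma β / 2 := by
    have hcont : Continuous (fun x : ℝ => (T - x) ^ β / β) :=
      (((Real.continuous_rpow_const hβ.le).comp (continuous_const.sub continuous_id))).div_const _
    have h1 : ∀ᶠ x in 𝓝[<] T, (T - x) ^ β / β < Real.Gamma β / 2 := by
      have := hcont.tendsto T
      simp only [sub_self, Real.zero_rpow hβ.ne', zero_div] at this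
      exact (this.mono_left nhdsWithin_le_nhds).eventually_lt_const (by positivity)
    have h2 : ∀ᶠ x in 𝓝[<] T, x ∈ Set.Ioo (T / 2) T := Ioo_mem_nhdsLT (by linarith)
    obtain ⟨x, hx1, hx2⟩ := (h1.and h2).exists
    exact ⟨x, hx2.1, hx2.2, hx1⟩
  obtain ⟨t, htm, hmax⟩ := (isCompact_Icc (a := t0) (b := T)).exists_isMaxOn
    ⟨t0, le_refl _, ht02.le⟩
    ((wML_contOn hβ hb0).mono (fun x hx => show (0:ℝ) < x by linarith [hx.1]))
  have hwt : 0 < wML β b t :=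
    lt_of_lt_of_le (hlt t0 (by linarith) ht02) (hmax ⟨le_refl _, ht02.le⟩)
  have htT : t < T := by
    rcases htm.2.lt_or_eq with h | h
    · exact h
    · rw [h] at hwt; linarith
  have ht0' : 0 < t := by linarith [htm.1]
  set ρ := (T / t) ^ (b - 1) with hρ
  have hρ0 : 0 < ρ := by positivity
  have hTt1 : 1 ≤ T / t := by rw [le_div_iff₀ ht0']; linarith
  have hρhalf : 1 / 2 ≤ ρ := by
    have h1 : T / t ≤ 2 := by rw [div_le_iff₀ ht0']; linarith [htm.1]
    calc (1:ℝ) / 2 = 2 ^ (-1 : ℝ) := by rw [Real.rpow_neg_one]; norm_num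
      _ ≤ 2 ^ (b - 1) := Real.rpow_le_rpow_of_exponent_le (by norm_num) (by linarith)
      _ ≤ ρ := Real.rpow_le_rpow_of_nonpos (by linarith) h1 (by linarith)
  have V1 := wML_volterra hβ hb0 hTpos
  have V2 := wML_volterra hβ hb0 ht0'
  have hTρ : T ^ (b - 1) = ρ * t ^ (b - 1) := by
    rw [hρ, ← Real.mul_rpow (by positivity) ht0'.le, div_mul_cancel₀ _ ht0'.ne']
  have hI1 := conv_int hβ hb0 hβ hTpos
  have hI2 := conv_int hβ hb0 hβ ht0'
  have hI1a := hI1.mono_set (Set.Ioc_subset_Ioc_right htT.le)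
  have hI1b := hI1.mono_set (Set.Ioc_subset_Ioc_left ht0'.le)
  have hsplit : ∫ s in Set.Ioc 0 T, (T - s) ^ (β - 1) * wML β b s =
      (∫ s in Set.Ioc 0 t, (T - s) ^ (β - 1) * wML β b s) +
      ∫ s in Set.Ioc t T, (T - s) ^ (β - 1) * wML β b s := by
    rw [← setIntegral_union (Set.Ioc_disjoint_Ioc_of_le le_rfl) measurableSet_Ioc hI1a hI1b,
      Set.Ioc_union_Ioc_eq_Ioc ht0'.le htT.le]
  have hcomp : ∫ s in Set.Ioc 0 t, (T - s) ^ (β - 1) * wML β b s ≤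
      ρ * ∫ s in Set.Ioc 0 t, (t - s) ^ (β - 1) * wML β b s := by
    rw [← integral_const_mul, integral_Ioc_eq_integral_Ioo, integral_Ioc_eq_integral_Ioo]
    refine setIntegral_mono_on (hI1a.mono_set Set.Ioo_subset_Ioc_self)
      ((hI2.mono_set Set.Ioo_subset_Ioc_self).const_mul ρ) measurableSet_Ioo (fun s hs => ?_)
    rw [← mul_assoc]
    refine mul_le_mul_of_nonneg_right ?_ (hlt s hs.1 (hs.2.trans htT)).le
    have hts : 0 < t - s := sub_pos.2 hs.2
    have e : T - s = (T - s) / (t - s) * (t - s) := by field_simp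
    have h0 : 0 < T - s := by linarith
    calc (T - s) ^ (β - 1) = ((T - s) / (t - s)) ^ (β - 1) * (t - s) ^ (β - 1) := by
          rw [← Real.mul_rpow (by positivity) hts.le, ← e]
      _ ≤ ρ * (t - s) ^ (β - 1) := by
          gcongr
          calc ((T - s) / (t - s)) ^ (β - 1) ≤ (T / t) ^ (β - 1) := by
                apply Real.rpow_le_rpow_of_nonpos (by positivity) _ (by linarith)
                rw [div_le_div_iff₀ ht0' hts]
                nlinarith [hs.1]
            _ ≤ ρ := Real.rpow_le_rpow_of_exponent_le hTt1 (by linarith)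
  have htail : ∫ s in Set.Ioc t T, (T - s) ^ (β - 1) * wML β b s ≤
      (T - t) ^ β / β * wML β b t := by
    obtain ⟨k1, k2⟩ := kern_int hβ htT.le
    rw [← k2, ← integral_mul_const]
    refine setIntegral_mono_on hI1b (k1.mul_const _) measurableSet_Ioc (fun s hs => ?_)
    refine mul_le_mul_of_nonneg_left (hmax ⟨htm.1.trans hs.1.le, hs.2⟩)
      (Real.rpow_nonneg (sub_nonneg.2 hs.2) _)
  have hmono : (T - t) ^ β / β ≤ (T - t0) ^ β / β := by
    have : 0 ≤ T - t := by linarith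
    gcongr
    exact htm.1
  have h1 : Real.Gamma β * (ρ * wML β b t) ≤ (T - t) ^ β / β * wML β b t := by
    have V3 : Real.Gamma β * (T ^ (b - 1) / Real.Gamma b) =
        ρ * (Real.Gamma β * (t ^ (b - 1) / Real.Gamma b)) := by rw [hTρ]; ring
    rw [V1, V2, hsplit] at V3
    have : Real.Gamma β * wML β b T ≤ 0 := mul_nonpos_of_nonneg_of_nonpos hGβ.le hwT
    linarith
  have h2 : Real.Gamma β * ρ ≤ (T - t) ^ β / β := by
    rw [← mul_assoc] at h1
    exact le_of_mul_le_mul_right h1 hwt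
  have h3 : Real.Gamma β * (1 / 2) ≤ Real.Gamma β * ρ := by gcongr
  linarith

lemma u_formula {β t : ℝ} (hβ : 0 < β) (ht : 0 ≤ t) :
    IntegrableOn (wML β β) (Set.Ioc 0 t) ∧
    ML2 β 1 (-(t ^ β)) = 1 - ∫ s in Set.Ioc 0 t, wML β β s := by
  rcases ht.lt_or_eq with h | h
  · have h1 := conv_int hβ hβ one_pos h
    have h2 := conv_eq hβ hβ one_pos h
    simp only [sub_self, Real.rpow_zero, one_mul, Real.Gamma_one] at h1 h2
    refine ⟨h1, ?_⟩
    rw [h2, ml_rec hβ one_pos, wML, add_comm 1 β]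
    simp
    ring
  · subst h
    rw [ml_rec hβ one_pos]
    simp [Real.zero_rpow hβ.ne']

lemma ml_anti {β : ℝ} (hβ : 0 < β) (hβ1 : β < 1) {y z : ℝ} (hy : 0 ≤ y) (hyz : y ≤ z) :
    mittagLeffler β (-z) ≤ mittagLeffler β (-y) := by
  change ML2 β 1 (-z) ≤ ML2 β 1 (-y)
  have hz : 0 ≤ z := hy.trans hyz
  have ey : y = (y ^ (1 / β)) ^ β := by
    rw [← Real.rpow_mul hy, one_div, inv_mul_cancel₀ hβ.ne', Real.rpow_one]
  have ez : z = (z ^ (1 / β)) ^ β := by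
    rw [← Real.rpow_mul hz, one_div, inv_mul_cancel₀ hβ.ne', Real.rpow_one]
  have hle : y ^ (1 / β) ≤ z ^ (1 / β) := Real.rpow_le_rpow hy hyz (by positivity)
  have hy' : 0 ≤ y ^ (1 / β) := by positivity
  obtain ⟨_, f1⟩ := u_formula hβ hy'
  obtain ⟨i2, f2⟩ := u_formula hβ (hy'.trans hle)
  rw [ey, ez, f1, f2]
  have := setIntegral_mono_set i2 (s := Set.Ioc 0 (y ^ (1 / β))) ?_
    (Set.Ioc_subset_Ioc_right hle).eventuallyLE
  · linarith
  · filter_upwards [ae_restrict_mem measurableSet_Ioc] with s hs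
    have := ml_pos hβ hβ1 le_rfl hβ1.le hs.1.le
    have hs0 : 0 < s := hs.1
    simp only [Pi.zero_apply, wML]
    positivity

lemma ml_pos' {β : ℝ} (hβ : 0 < β) (hβ1 : β < 1) {y : ℝ} (hy : 0 ≤ y) :
    0 < mittagLeffler β (-y) := by
  change 0 < ML2 β 1 (-y)
  have ey : y = (y ^ (1 / β)) ^ β := by
    rw [← Real.rpow_mul hy, one_div, inv_mul_cancel₀ hβ.ne', Real.rpow_one]
  rw [ey]
  exact ml_pos hβ hβ1 hβ1.le le_rfl (by positivity)

lemma ml_le_one {β : ℝ} (hβ : 0 < β) (hβ1 : β < 1) {y : ℝ} (hy : 0 ≤ y) :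
    mittagLeffler β (-y) ≤ 1 := by
  refine (ml_anti hβ hβ1 le_rfl hy).trans ?_
  change ML2 β 1 (-0) ≤ 1
  rw [ml_rec hβ one_pos]; simp

lemma ml_decay {β : ℝ} (hβ : 0 < β) (hβ1 : β < 1) {y : ℝ} (hy : 0 < y) :
    y * mittagLeffler β (-y) ≤ β * Real.Gamma β := by
  set t := y ^ (1 / β) with ht
  have ht0 : 0 < t := by positivity
  have ey : t ^ β = y := by
    rw [ht, ← Real.rpow_mul hy.le, one_div, inv_mul_cancel₀ hβ.ne', Real.rpow_one]
  have V := wML_volterra hβ one_pos ht0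
  have hw : ∀ s, wML β 1 s = mittagLeffler β (-(s ^ β)) := fun s => by
    simp [wML]; rfl
  have hI := conv_int hβ one_pos hβ ht0
  simp_rw [hw] at V hI
  obtain ⟨k1, k2⟩ := kern_int hβ ht0.le
  have hle : (∫ s in Set.Ioc 0 t, (t - s) ^ (β - 1)) * mittagLeffler β (-(t ^ β)) ≤
      ∫ s in Set.Ioc 0 t, (t - s) ^ (β - 1) * mittagLeffler β (-(s ^ β)) := by
    rw [← integral_mul_const]
    refine setIntegral_mono_on (k1.mul_const _) hI measurableSet_Ioc (fun s hs => ?_)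
    refine mul_le_mul_of_nonneg_left ?_ (Real.rpow_nonneg (sub_nonneg.2 hs.2) _)
    exact ml_anti hβ hβ1 (Real.rpow_nonneg hs.1.le _) (Real.rpow_le_rpow hs.1.le hs.2 hβ.le)
  rw [k2, sub_zero, ey] at hle
  rw [ey] at V
  have hp := ml_pos' hβ hβ1 hy.le
  have hG := Real.Gamma_pos_of_pos hβ
  have : y / β * mittagLeffler β (-y) ≤ Real.Gamma β := by
    simp only [sub_self, Real.rpow_zero, Real.Gamma_one, div_one, mul_one] at V
    nlinarith [mul_pos hG hp]
  calc y * mittagLeffler β (-y) = β * (y / β * mittagLeffler β (-y)) := by field_simp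
    _ ≤ _ := by gcongr

/-- Rescaled Bessel integral. -/
noncomputable def besP (ν z : ℝ) : ℝ :=
  ∫ r in Set.Ioi (0 : ℝ), r ^ (ν - 1) * Real.exp (-r - z ^ 2 / (4 * r))

lemma bessel_eq {ν z : ℝ} (hz : 0 < z) :
    z ^ ν * besselK (-ν) z = 1 / 2 * 2 ^ ν * besP ν z := by
  unfold besselK
  have h1 := integral_comp_rpow_Ioi
    (fun s : ℝ => s ^ (-ν - 1) * Real.exp (-(z / 2) * (s + 1 / s))) (p := -1) (by norm_num)
  rw [← h1]
  have h2 : ∫ x in Set.Ioi (0:ℝ), (|(-1:ℝ)| * x ^ ((-1:ℝ) - 1)) •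
      ((x ^ (-1:ℝ)) ^ (-ν - 1) * Real.exp (-(z / 2) * (x ^ (-1:ℝ) + 1 / x ^ (-1:ℝ)))) =
      ∫ x in Set.Ioi (0:ℝ), x ^ (ν - 1) * Real.exp (-(z / 2) * (x + 1 / x)) := by
    refine setIntegral_congr_fun measurableSet_Ioi (fun x hx => ?_)
    have hx0 : 0 < x := hx
    simp only [smul_eq_mul]
    rw [← Real.rpow_mul hx0.le, abs_neg, abs_one, one_mul, ← mul_assoc, ← Real.rpow_add hx0,
      Real.rpow_neg_one, one_div, one_div, inv_inv, add_comm x⁻¹ x]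
    congr 2
    ring
  rw [h2]
  have h3 := integral_comp_mul_left_Ioi
    (fun x : ℝ => x ^ (ν - 1) * Real.exp (-(z / 2) * (x + 1 / x))) 0 (b := 2 / z) (by positivity)
  rw [mul_zero] at h3
  have h4 : ∫ x in Set.Ioi (0:ℝ), (2 / z * x) ^ (ν - 1) *
      Real.exp (-(z / 2) * (2 / z * x + 1 / (2 / z * x))) = (2 / z) ^ (ν - 1) * besP ν z := by
    unfold besP
    rw [← integral_const_mul]
    refine setIntegral_congr_fun measurableSet_Ioi (fun x hx => ?_)
    have hx0 : 0 < x := hx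
    rw [Real.mul_rpow (by positivity) hx0.le, mul_assoc]
    congr 3
    field_simp
    ring
  rw [h4, smul_eq_mul] at h3
  have h5 : ∫ x in Set.Ioi (0:ℝ), x ^ (ν - 1) * Real.exp (-(z / 2) * (x + 1 / x))
      = (2 / z) * ((2 / z) ^ (ν - 1) * besP ν z) := by
    rw [h3]; field_simp
  rw [h5, Real.rpow_sub_one (by positivity), Real.div_rpow (by norm_num) hz.le]
  field_simp

lemma besP_bound {ν : ℝ} (z r : ℝ) (hr : 0 < r) :
    r ^ (ν - 1) * Real.exp (-r - z ^ 2 / (4 * r)) ≤ Real.exp (-r) * r ^ (ν - 1) := by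
  rw [mul_comm]
  have : -r - z ^ 2 / (4 * r) ≤ -r := by
    have : 0 ≤ z ^ 2 / (4 * r) := by positivity
    linarith
  gcongr

lemma besP_meas (ν z : ℝ) : Measurable
    (fun r : ℝ => r ^ (ν - 1) * Real.exp (-r - z ^ 2 / (4 * r))) := by
  fun_prop

lemma besP_cont {ν : ℝ} (hν : 0 < ν) : Continuous (besP ν) := by
  unfold besP
  refine continuous_of_dominated (bound := fun r => Real.exp (-r) * r ^ (ν - 1))
    (fun z => (besP_meas ν z).aestronglyMeasurable) (fun z => ?_)
    (Real.GammaIntegral_convergent hν) ?_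
  · filter_upwards [ae_restrict_mem measurableSet_Ioi] with r hr
    have hr0 : 0 < r := hr
    rw [Real.norm_of_nonneg (by positivity)]
    exact besP_bound z r hr
  · filter_upwards with r
    fun_prop

lemma besP_zero {ν : ℝ} (hν : 0 < ν) : besP ν 0 = Real.Gamma ν := by
  rw [Real.Gamma_eq_integral hν, besP]
  congr 1; ext r
  simp [mul_comm]

lemma besP_nonneg (ν z : ℝ) : 0 ≤ besP ν z :=
  setIntegral_nonneg measurableSet_Ioi (fun r hr => by
    have hr0 : 0 < r := hr
    positivity)

lemma besP_le {ν : ℝ} (hν : 0 < ν) (z : ℝ) : besP ν z ≤ Real.Gamma ν := by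
  rw [Real.Gamma_eq_integral hν, besP]
  refine setIntegral_mono_on ?_ (Real.GammaIntegral_convergent hν) measurableSet_Ioi
    (fun r hr => besP_bound z r hr)
  refine (Real.GammaIntegral_convergent hν).mono' (besP_meas ν z).aestronglyMeasurable ?_
  filter_upwards [ae_restrict_mem measurableSet_Ioi] with r hr
  have hr0 : 0 < r := hr
  rw [Real.norm_of_nonneg (by positivity)]
  exact besP_bound z r hr

lemma theta_const {κ : ℝ} (h0 : 0 < κ) (h1 : κ < 1) :
    (2 : ℝ) ^ ((3 - κ) / 2) * Real.Gamma κ * Real.cos (Real.pi * κ / 2) /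
      (Real.sqrt Real.pi * Real.Gamma (κ / 2)) * (1 / 2 * 2 ^ ((1 - κ) / 2))
      = 1 / Real.Gamma ((1 - κ) / 2) := by
  have hd := Real.Gamma_mul_Gamma_add_half (κ / 2)
  have hr := Real.Gamma_mul_Gamma_one_sub ((1 - κ) / 2)
  rw [show 2 * (κ / 2) = κ by ring] at hd
  rw [show 1 - (1 - κ) / 2 = κ / 2 + 1 / 2 by ring,
    show π * ((1 - κ) / 2) = π / 2 - π * κ / 2 by ring, Real.sin_pi_div_two_sub] at hr
  have hG1 : 0 < Real.Gamma (κ / 2) := Real.Gamma_pos_of_pos (by linarith)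
  have hG2 : 0 < Real.Gamma ((1 - κ) / 2) := Real.Gamma_pos_of_pos (by linarith)
  have hG3 : 0 < Real.Gamma κ := Real.Gamma_pos_of_pos h0
  have hG4 : 0 < Real.Gamma (κ / 2 + 1 / 2) := Real.Gamma_pos_of_pos (by linarith)
  have hcos : 0 < Real.cos (π * κ / 2) :=
    Real.cos_pos_of_mem_Ioo ⟨by nlinarith [Real.pi_pos], by nlinarith [Real.pi_pos]⟩
  have hsq : √π * √π = π := Real.mul_self_sqrt Real.pi_pos.le
  have hs : 0 < √π := by positivity
  have h2 : (2:ℝ) ^ ((3 - κ) / 2) * 2 ^ ((1 - κ) / 2) = 2 * 2 ^ (1 - κ) := by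
    rw [← Real.rpow_add (by norm_num), ← Real.rpow_one_add' (by norm_num) (by linarith)]
    congr 1; ring
  set A := (2:ℝ) ^ ((3 - κ) / 2)
  set B := (2:ℝ) ^ ((1 - κ) / 2)
  set D := (2:ℝ) ^ (1 - κ)
  rw [eq_div_iff hcos.ne'] at hr
  rw [eq_div_iff hG2.ne']
  have e : A * Real.Gamma κ * Real.cos (π * κ / 2) / (√π * Real.Gamma (κ / 2)) * (1 / 2 * B) *
      Real.Gamma ((1 - κ) / 2) = (A * B) / 2 * Real.Gamma κ * Real.cos (π * κ / 2) *
      Real.Gamma ((1 - κ) / 2) / (√π * Real.Gamma (κ / 2)) := by ring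
  rw [e, h2, div_eq_one_iff_eq (by positivity)]
  have hd' : Real.Gamma κ * D = Real.Gamma (κ / 2) * Real.Gamma (κ / 2 + 1 / 2) / √π := by
    rw [hd]; field_simp
  calc 2 * D / 2 * Real.Gamma κ * Real.cos (π * κ / 2) * Real.Gamma ((1 - κ) / 2)
      = (Real.Gamma κ * D) * Real.cos (π * κ / 2) * Real.Gamma ((1 - κ) / 2) := by ring
    _ = Real.Gamma (κ / 2) / √π * (Real.Gamma ((1 - κ) / 2) * Real.Gamma (κ / 2 + 1 / 2) *
        Real.cos (π * κ / 2)) := by rw [hd']; ring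
    _ = √π * Real.Gamma (κ / 2) := by
        rw [hr]; nth_rewrite 2 [← hsq]; field_simp

lemma theta_eq {κ z : ℝ} (h0 : 0 < κ) (h1 : κ < 1) (hz : 0 < z) :
    1 - theta κ z = besP ((1 - κ) / 2) z / Real.Gamma ((1 - κ) / 2) := by
  have hc := theta_const h0 h1
  have hb := bessel_eq (ν := (1 - κ) / 2) hz
  unfold theta
  rw [show (κ - 1) / 2 = -((1 - κ) / 2) by ring, sub_sub_cancel, mul_assoc, hb, ← mul_assoc, hc]
  ring

lemma integrable_abs_of_Ioi {f : ℝ → ℝ} (hf : IntegrableOn f (Set.Ioi 0)) :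
    Integrable (fun x => f |x|) := by
  have h1 : IntegrableOn (fun x => f |x|) (Set.Ioi 0) :=
    hf.congr_fun (fun x hx => by
      have hx0 : 0 < x := hx
      simp [abs_of_pos hx0]) measurableSet_Ioi
  have h2 : IntegrableOn (fun x ↦ f |x|) (Set.Iic 0) := by
    rw [← Measure.map_neg_eq_self (volume : Measure ℝ)]
    let m : MeasurableEmbedding fun x : ℝ => -x := (Homeomorph.neg ℝ).measurableEmbedding
    rw [m.integrableOn_map_iff]
    simp_rw [Function.comp_def, abs_neg, Set.neg_preimage, Set.neg_Iic, neg_zero]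
    exact Iff.mpr integrableOn_Ici_iff_integrableOn_Ioi h1
  rw [← integrableOn_univ, ← Set.Iic_union_Ioi (a := (0:ℝ))]
  exact h2.union h1

lemma mittagLeffler_cont {β : ℝ} (hβ : 0 < β) : Continuous (mittagLeffler β) :=
  ml_continuous hβ one_pos

lemma limit_integrable {κ₀ α β m : ℝ} (h0 : 0 < κ₀) (hα : κ₀ / 2 < α) (hβ : 0 < β)
    (hβ1 : β < 1) (hm : 0 < m) :
    Integrable (fun lam : ℝ => (mittagLeffler β (-(m * |lam| ^ α))) ^ 2 * |lam| ^ (κ₀ - 1)) := by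
  have hα0 : 0 < α := by linarith
  refine integrable_abs_of_Ioi
    (f := fun x => (mittagLeffler β (-(m * x ^ α))) ^ 2 * x ^ (κ₀ - 1)) ?_
  have hmeas : Measurable (fun x : ℝ => (mittagLeffler β (-(m * x ^ α))) ^ 2 * x ^ (κ₀ - 1)) := by
    have := (mittagLeffler_cont hβ).measurable
    fun_prop
  have hG := Real.Gamma_pos_of_pos hβ
  rw [← Set.Ioc_union_Ioi_eq_Ioi zero_le_one]
  refine IntegrableOn.union ?_ ?_
  · have hi : IntegrableOn (fun x : ℝ => x ^ (κ₀ - 1)) (Set.Ioc 0 1) := by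
      rw [← intervalIntegrable_iff_integrableOn_Ioc_of_le zero_le_one]
      exact intervalIntegral.intervalIntegrable_rpow' (by linarith)
    refine hi.mono' hmeas.aestronglyMeasurable ?_
    filter_upwards [ae_restrict_mem measurableSet_Ioc] with x hx
    have hx0 : 0 < x := hx.1
    rw [Real.norm_of_nonneg (by positivity)]
    have hp := ml_pos' hβ hβ1 (y := m * x ^ α) (by positivity)
    have hl := ml_le_one hβ hβ1 (y := m * x ^ α) (by positivity)
    have : (mittagLeffler β (-(m * x ^ α))) ^ 2 ≤ 1 := pow_le_one₀ hp.le hl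
    have h3 : 0 ≤ x ^ (κ₀ - 1) := by positivity
    nlinarith
  · have hi : IntegrableOn (fun x : ℝ => (β * Real.Gamma β / m) ^ 2 * x ^ (κ₀ - 1 - 2 * α))
        (Set.Ioi 1) :=
      (integrableOn_Ioi_rpow_of_lt (by linarith) one_pos).const_mul _
    refine hi.mono' hmeas.aestronglyMeasurable ?_
    filter_upwards [ae_restrict_mem measurableSet_Ioi] with x hx
    have hx0 : 0 < x := lt_trans one_pos hx
    rw [Real.norm_of_nonneg (by positivity)]
    have hp := ml_pos' hβ hβ1 (y := m * x ^ α) (by positivity)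
    have hd := ml_decay hβ hβ1 (y := m * x ^ α) (by positivity)
    have hxa : 0 < x ^ α := by positivity
    have h1 : mittagLeffler β (-(m * x ^ α)) ≤ β * Real.Gamma β / m * (x ^ α)⁻¹ := by
      rw [← div_eq_mul_inv, div_div, le_div_iff₀ (by positivity)]
      linarith
    have e : x ^ (κ₀ - 1 - 2 * α) = ((x ^ α)⁻¹) ^ 2 * x ^ (κ₀ - 1) := by
      rw [Real.rpow_sub hx0, mul_comm 2 α, Real.rpow_mul hx0.le, Real.rpow_two]
      field_simp
    rw [e, ← mul_assoc, ← mul_pow]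
    gcongr

/-- For `κ₀ ∈ (0,1)` and `α > κ₀/2`,
`∫_ℝ E_β²(−μ|λ|^α(1+λ²ε²)^{γ/2} t^β)(1 − θ_{κ₀}(|λ|ε))|λ|^{κ₀−1} dλ
  → ∫_ℝ E_β²(−μ|λ|^α t^β)|λ|^{κ₀−1} dλ` as `ε → 0⁺`, and both integrals are finite. -/
theorem theta_weighted_integral_limit (κ₀ α β γ μ t : ℝ)
    (hκ₀ : κ₀ ∈ Set.Ioo (0 : ℝ) 1) (hα : κ₀ / 2 < α) (hβ : β ∈ Set.Ioo (0 : ℝ) 1)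
    (hγ : 0 < γ) (hμ : 0 < μ) (ht : 0 < t) :
    (∀ ε : ℝ, 0 < ε →
      MeasureTheory.Integrable
        (fun lam : ℝ =>
          (mittagLeffler β (-(μ * |lam| ^ α * (1 + lam ^ 2 * ε ^ 2) ^ (γ / 2) * t ^ β))) ^ 2 *
            (1 - theta κ₀ (|lam| * ε)) * |lam| ^ (κ₀ - 1))) ∧
    MeasureTheory.Integrable
      (fun lam : ℝ =>
        (mittagLeffler β (-(μ * |lam| ^ α * t ^ β))) ^ 2 * |lam| ^ (κ₀ - 1)) ∧
    Filter.Tendsto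
      (fun ε : ℝ =>
        ∫ lam : ℝ,
          (mittagLeffler β (-(μ * |lam| ^ α * (1 + lam ^ 2 * ε ^ 2) ^ (γ / 2) * t ^ β))) ^ 2 *
            (1 - theta κ₀ (|lam| * ε)) * |lam| ^ (κ₀ - 1))
      (𝓝[>] (0 : ℝ))
      (𝓝 (∫ lam : ℝ,
        (mittagLeffler β (-(μ * |lam| ^ α * t ^ β))) ^ 2 * |lam| ^ (κ₀ - 1))) := by
  obtain ⟨hκ0, hκ1⟩ := hκ₀
  obtain ⟨hβ0, hβ1⟩ := hβ
  have hα0 : 0 < α := by linarith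
  set ν := (1 - κ₀) / 2 with hν
  have hν0 : 0 < ν := by rw [hν]; linarith
  have hGν := Real.Gamma_pos_of_pos hν0
  have htβ : 0 < t ^ β := by positivity
  have hMc := mittagLeffler_cont hβ0
  have hlim : Integrable (fun lam : ℝ =>
      (mittagLeffler β (-(μ * |lam| ^ α * t ^ β))) ^ 2 * |lam| ^ (κ₀ - 1)) := by
    have := limit_integrable hκ0 hα hβ0 hβ1 (m := μ * t ^ β) (by positivity)
    refine this.congr (ae_of_all _ fun lam => ?_)
    simp only
    rw [mul_right_comm]
  -- the integrand, rewritten almost everywhere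
  set F : ℝ → ℝ → ℝ := fun ε lam =>
    (mittagLeffler β (-(μ * |lam| ^ α * (1 + lam ^ 2 * ε ^ 2) ^ (γ / 2) * t ^ β))) ^ 2 *
      (besP ν (|lam| * ε) / Real.Gamma ν) * |lam| ^ (κ₀ - 1) with hF
  have hne : ∀ᵐ lam : ℝ, lam ≠ 0 := by
    simp [ae_iff, measure_singleton]
  have hFeq : ∀ ε : ℝ, 0 < ε → F ε =ᵐ[volume] (fun lam : ℝ =>
      (mittagLeffler β (-(μ * |lam| ^ α * (1 + lam ^ 2 * ε ^ 2) ^ (γ / 2) * t ^ β))) ^ 2 *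
        (1 - theta κ₀ (|lam| * ε)) * |lam| ^ (κ₀ - 1)) := by
    intro ε hε
    filter_upwards [hne] with lam hl
    rw [theta_eq hκ0 hκ1 (mul_pos (abs_pos.2 hl) hε)]
  have hFm : ∀ ε : ℝ, AEStronglyMeasurable (F ε) volume := by
    intro ε
    have h1 := hMc.measurable
    have h2 := (besP_cont hν0).measurable
    have : Measurable (F ε) := by
      simp only [hF]
      fun_prop
    exact this.aestronglyMeasurable
  have hFb : ∀ ε lam : ℝ, ‖F ε lam‖ ≤
      (mittagLeffler β (-(μ * |lam| ^ α * t ^ β))) ^ 2 * |lam| ^ (κ₀ - 1) := by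
    intro ε lam
    have hq0 : 0 ≤ besP ν (|lam| * ε) / Real.Gamma ν :=
      div_nonneg (besP_nonneg _ _) hGν.le
    have hq1 : besP ν (|lam| * ε) / Real.Gamma ν ≤ 1 :=
      (div_le_one hGν).2 (besP_le hν0 _)
    have hge : 1 ≤ (1 + lam ^ 2 * ε ^ 2) ^ (γ / 2) :=
      Real.one_le_rpow (by nlinarith [mul_nonneg (sq_nonneg lam) (sq_nonneg ε)]) (by positivity)
    have hy0 : 0 ≤ μ * |lam| ^ α * t ^ β := by positivity
    have hyz : μ * |lam| ^ α * t ^ β ≤ μ * |lam| ^ α * (1 + lam ^ 2 * ε ^ 2) ^ (γ / 2) * t ^ β := by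
      have : 0 ≤ μ * |lam| ^ α := by positivity
      have := le_mul_of_one_le_right this hge
      gcongr
    have ha := ml_anti hβ0 hβ1 hy0 hyz
    have hp := ml_pos' hβ0 hβ1 (hy0.trans hyz)
    have hsq := pow_le_pow_left₀ hp.le ha 2
    have hl : 0 ≤ |lam| ^ (κ₀ - 1) := by positivity
    simp only [hF]
    rw [Real.norm_of_nonneg (by positivity)]
    refine mul_le_mul_of_nonneg_right ?_ hl
    calc _ ≤ _ * 1 := mul_le_mul_of_nonneg_left hq1 (sq_nonneg _)
      _ ≤ _ := by rw [mul_one]; exact hsq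
  refine ⟨fun ε hε => ?_, hlim, ?_⟩
  · exact (hlim.mono' (hFm ε) (ae_of_all _ (hFb ε))).congr (hFeq ε hε)
  · have hT : Tendsto (fun ε : ℝ => ∫ lam, F ε lam) (𝓝[>] (0 : ℝ))
        (𝓝 (∫ lam : ℝ,
          (mittagLeffler β (-(μ * |lam| ^ α * t ^ β))) ^ 2 * |lam| ^ (κ₀ - 1))) := by
      refine tendsto_integral_filter_of_dominated_convergence _
        (Eventually.of_forall hFm) (Eventually.of_forall fun ε => ae_of_all _ (hFb ε)) hlim
        (ae_of_all _ fun lam => ?_)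
      have hP := besP_cont hν0
      have hr : Continuous (fun ε : ℝ => (1 + lam ^ 2 * ε ^ 2) ^ (γ / 2)) :=
        (Real.continuous_rpow_const (by positivity)).comp (by fun_prop)
      have hc : Continuous (fun ε => F ε lam) := by
        simp only [hF]
        fun_prop
      have h := (hc.tendsto 0).mono_left (nhdsWithin_le_nhds (s := Set.Ioi 0))
      have e : F 0 lam =
          (mittagLeffler β (-(μ * |lam| ^ α * t ^ β))) ^ 2 * |lam| ^ (κ₀ - 1) := by
        simp [hF, besP_zero hν0, hGν.ne']
      rwa [e] at h
    refine hT.congr' ?_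
    filter_upwards [self_mem_nhdsWithin] with ε hε
    exact integral_congr_ae (hFeq ε hε)
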